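/- arXiv:2504.00220 — 2 statements merged into one kernel-verified Lean document; each statement's English description precedes it below -/
import Mathlib

section
/- Let U, Y: Ω → ℝ^{m×k} be random matrices on a probability space such that M := E[U(X)^⊤ Y(X)] is positive semidefinite. Let X, X' be i.i.d. Then E‖U(X)U(X')^⊤ − Y(X)Y(X')^⊤‖_F² ≥ (1/2)·E‖(U(X)−Y(X))(U(X')−Y(X'))^⊤‖_F². -/
open MeasureTheory ProbabilityTheory Matrix

/-- If the Gram kernel `⟪v x, v y⟫` of a map into a finite-dimensional space is integrable on the
product, then `v` is weakly integrable. No measurability of `v` is assumed. -/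
theorem integrable_inner_of_integrable_gram {Ω E : Type*} [MeasurableSpace Ω] {μ : Measure Ω}
    [SFinite μ] [NormedAddCommGroup E] [InnerProductSpace ℝ E] [FiniteDimensional ℝ E]
    (v : Ω → E) (h : Integrable (fun p : Ω × Ω => inner ℝ (v p.1) (v p.2)) (μ.prod μ)) (w : E) :
    Integrable (fun x => inner ℝ (v x) w) μ := by
  let good : Set Ω := {y | Integrable (fun x => inner ℝ (v x) (v y)) μ}
  have hgood : ∀ᵐ y ∂μ, y ∈ good := h.prod_left_ae
  let W : Submodule ℝ E := Submodule.span ℝ (v '' good)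
  have hW : ∀ u ∈ W, Integrable (fun x => inner ℝ (v x) u) μ := by
    intro u hu
    induction hu using Submodule.span_induction with
    | mem u hu => obtain ⟨y, hy, rfl⟩ := hu; exact hy
    | zero => simp
    | add u u' _ _ hu hu' => simp only [inner_add_right]; exact hu.add hu'
    | smul c u _ hu => simpa only [inner_smul_right] using hu.const_mul c
  refine (hW _ (W.starProjection_apply_mem w)).congr ?_
  filter_upwards [hgood] with x hx
  have hvx : v x ∈ W := Submodule.subset_span ⟨x, hx, rfl⟩
  rw [← Submodule.inner_starProjection_left_eq_right, Submodule.starProjection_eq_self_iff.mpr hvx]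

theorem sum_mul_transpose_mul_sum_mul_transpose {m n k : Type*} [Fintype m] [Fintype n] [Fintype k]
    (P R : Matrix m k ℝ) (Q S : Matrix n k ℝ) :
    ∑ i, ∑ j, (P * Qᵀ) i j * (R * Sᵀ) i j = ∑ a, ∑ b, (Pᵀ * R) a b * (Qᵀ * S) a b := by
  have htrace : ((P * Qᵀ) * (R * Sᵀ)ᵀ).trace = ((Pᵀ * R) * (Qᵀ * S)ᵀ).trace := by
    rw [← trace_transpose ((Pᵀ * R) * (Qᵀ * S)ᵀ)]
    simp only [transpose_mul, transpose_transpose, Matrix.mul_assoc]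
    rw [trace_mul_comm]
    simp only [Matrix.mul_assoc]
  simpa only [← sum_hadamard_eq, hadamard_apply] using htrace

theorem sum_sq_sub_mul_transpose {m n k : Type*} [Fintype m] [Fintype n] [Fintype k]
    (P R : Matrix m k ℝ) (Q S : Matrix n k ℝ) :
    ∑ i, ∑ j, ((P * Qᵀ - R * Sᵀ) i j) ^ 2 =
      ∑ a, ∑ b, ((Pᵀ * P) a b * (Qᵀ * Q) a b + (Rᵀ * R) a b * (Sᵀ * S) a b
        - 2 * ((Pᵀ * R) a b * (Qᵀ * S) a b)) := by
  simp only [Finset.sum_sub_distrib, Finset.sum_add_distrib, ← Finset.mul_sum,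
    ← sum_mul_transpose_mul_sum_mul_transpose, Matrix.sub_apply, sub_sq]
  simp only [Finset.mul_sum, pow_two, mul_assoc]
  ring

theorem integral_add_sub {Ω : Type*} [MeasurableSpace Ω] {μ : Measure Ω} {f g h : Ω → ℝ}
    (hf : Integrable f μ) (hg : Integrable g μ) (hh : Integrable h μ) :
    ∫ x, (f x + g x - h x) ∂μ = (∫ x, f x ∂μ) + (∫ x, g x ∂μ) - ∫ x, h x ∂μ := by
  rw [← integral_add hf hg]
  exact integral_sub (hf.add hg) hh

theorem integral_sum_mul_prod {Ω ι κ : Type*} [MeasurableSpace Ω] {μ : Measure Ω} [SFinite μ]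
    [Fintype ι] [Fintype κ] (f : Ω → ι → κ → ℝ) (hf : ∀ a b, Integrable (fun x => f x a b) μ) :
    ∫ p : Ω × Ω, ∑ a, ∑ b, f p.1 a b * f p.2 a b ∂(μ.prod μ)
      = ∑ a, ∑ b, (∫ x, f x a b ∂μ) ^ 2 := by
  rw [integral_finsetSum _ fun a _ => integrable_finsetSum _ fun b _ => (hf a b).mul_prod (hf a b)]
  refine Finset.sum_congr rfl fun a _ => ?_
  rw [integral_finsetSum _ fun b _ => (hf a b).mul_prod (hf a b)]
  refine Finset.sum_congr rfl fun b _ => ?_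
  rw [integral_prod_mul (fun x => f x a b) (fun x => f x a b), sq]

theorem sum_mul_transpose_mul_self_nonneg {m k : Type*} [Fintype m] [Fintype k]
    {M : Matrix k k ℝ} (hM : M.PosSemidef) (D : Matrix m k ℝ) :
    0 ≤ ∑ a, ∑ b, M a b * (Dᵀ * D) a b := by
  have h : ∑ a, ∑ b, M a b * (Dᵀ * D) a b = ∑ i, D i ⬝ᵥ M *ᵥ D i := by
    simp only [Matrix.mul_apply, transpose_apply, dotProduct, mulVec, Finset.mul_sum]
    rw [Finset.sum_comm (s := Finset.univ (α := m))]
    refine Finset.sum_congr rfl fun a _ => ?_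
    rw [Finset.sum_comm]
    exact Finset.sum_congr rfl fun i _ => Finset.sum_congr rfl fun b _ => by ring
  rw [h]
  exact Finset.sum_nonneg fun i _ => by simpa using hM.dotProduct_mulVec_nonneg (D i)

/-- For random matrices `U, Y` with `E[UᵀY]` positive semidefinite and an i.i.d. pair
(modeled by the product measure `ℙ ⊗ ℙ`),
`E‖U(X)U(X')ᵀ − Y(X)Y(X')ᵀ‖_F² ≥ (1/2)·E‖(U(X)−Y(X))(U(X')−Y(X'))ᵀ‖_F²`. -/
theorem stmt8 {Ω : Type*} [MeasureSpace Ω] [IsProbabilityMeasure (ℙ : Measure Ω)]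
    {m k : ℕ} (U Y : Ω → Matrix (Fin m) (Fin k) ℝ)
    (hIntUY : ∀ i j, Integrable (fun ω => ((U ω)ᵀ * Y ω) i j) ℙ)
    (hInt₁ : Integrable (fun p : Ω × Ω =>
        ∑ i, ∑ i', ((U p.1 * (U p.2)ᵀ - Y p.1 * (Y p.2)ᵀ) i i') ^ 2) (Measure.prod ℙ ℙ))
    (hInt₂ : Integrable (fun p : Ω × Ω =>
        ∑ i, ∑ i', (((U p.1 - Y p.1) * (U p.2 - Y p.2)ᵀ) i i') ^ 2) (Measure.prod ℙ ℙ))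
    (hPSD : (Matrix.of fun i j => ∫ ω, ((U ω)ᵀ * Y ω) i j).PosSemidef) :
    (1 / 2) * ∫ p : Ω × Ω,
        ∑ i, ∑ i', (((U p.1 - Y p.1) * (U p.2 - Y p.2)ᵀ) i i') ^ 2 ∂(Measure.prod ℙ ℙ)
      ≤ ∫ p : Ω × Ω,
        ∑ i, ∑ i', ((U p.1 * (U p.2)ᵀ - Y p.1 * (Y p.2)ᵀ) i i') ^ 2 ∂(Measure.prod ℙ ℙ) := by
  have hUU_YY : (∀ a b, Integrable (fun ω => ((U ω)ᵀ * U ω) a b) ℙ) ∧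
      ∀ a b, Integrable (fun ω => ((Y ω)ᵀ * Y ω) a b) ℙ := by
    let v : Ω → EuclideanSpace ℝ ((Fin k × Fin k) ⊕ (Fin k × Fin k)) := fun ω =>
      WithLp.toLp 2 (Sum.elim (fun q => ((U ω)ᵀ * U ω) q.1 q.2) (fun q => ((Y ω)ᵀ * Y ω) q.1 q.2))
    have hC : Integrable (fun p : Ω × Ω => ∑ a, ∑ b,
        2 * (((U p.1)ᵀ * Y p.1) a b * ((U p.2)ᵀ * Y p.2) a b)) (Measure.prod ℙ ℙ) :=
      integrable_finsetSum _ fun a _ => integrable_finsetSum _ fun b _ =>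
        ((hIntUY a b).mul_prod (hIntUY a b)).const_mul 2
    have hv := integrable_inner_of_integrable_gram (μ := (ℙ : Measure Ω)) v <| by
      refine (hInt₁.add hC).congr (.of_forall fun p => ?_)
      simp only [Pi.add_apply, sum_sq_sub_mul_transpose, v, PiLp.inner_apply, Fintype.sum_sum_type,
        Sum.elim_inl, Sum.elim_inr, Fintype.sum_prod_type, RCLike.inner_apply, conj_trivial,
        ← Finset.sum_add_distrib]
      exact Finset.sum_congr rfl fun a _ => Finset.sum_congr rfl fun b _ => by ring
    constructor <;> intro a b
    · simpa [v, EuclideanSpace.inner_single_right] using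
        hv (EuclideanSpace.single (Sum.inl (a, b)) 1)
    · simpa [v, EuclideanSpace.inner_single_right] using
        hv (EuclideanSpace.single (Sum.inr (a, b)) 1)
  obtain ⟨hUU, hYY⟩ := hUU_YY
  have hYU (a b) : ∀ ω, ((Y ω)ᵀ * U ω) a b = ((U ω)ᵀ * Y ω) b a := fun ω => by
    simp [Matrix.mul_apply, mul_comm]
  have hΔ_apply (a b) (ω) : ((U ω - Y ω)ᵀ * (U ω - Y ω)) a b = ((U ω)ᵀ * U ω) a b
      + ((Y ω)ᵀ * Y ω) a b - ((U ω)ᵀ * Y ω) a b - ((U ω)ᵀ * Y ω) b a := by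
    rw [← hYU a b]
    simp only [transpose_sub, Matrix.sub_mul, Matrix.mul_sub, Matrix.sub_apply]
    ring
  have hΔ (a b) : Integrable (fun ω => ((U ω - Y ω)ᵀ * (U ω - Y ω)) a b) ℙ := by
    simp only [hΔ_apply]
    exact (((hUU a b).add (hYY a b)).sub (hIntUY a b)).sub (hIntUY b a)
  have hsymm (a b) : ∫ ω, ((U ω)ᵀ * Y ω) b a = ∫ ω, ((U ω)ᵀ * Y ω) a b := by
    simpa using hPSD.isHermitian.apply a b
  have hΔ_integral (a b) : ∫ ω, ((U ω - Y ω)ᵀ * (U ω - Y ω)) a b = (∫ ω, ((U ω)ᵀ * U ω) a b)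
      + (∫ ω, ((Y ω)ᵀ * Y ω) a b) - 2 * ∫ ω, ((U ω)ᵀ * Y ω) a b := by
    simp only [hΔ_apply]
    simp only [sub_sub]
    refine (integral_add_sub (hUU a b) (hYY a b) ((hIntUY a b).add (hIntUY b a))).trans ?_
    rw [integral_add' (hIntUY a b) (hIntUY b a), hsymm]
    ring
  have hcross : 0 ≤ ∑ a, ∑ b, (∫ ω, ((U ω)ᵀ * Y ω) a b) *
      ∫ ω, ((U ω - Y ω)ᵀ * (U ω - Y ω)) a b := by
    have hint : ∫ ω, ∑ a, ∑ b, (∫ ω', ((U ω')ᵀ * Y ω') a b) * ((U ω - Y ω)ᵀ * (U ω - Y ω)) a b =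
        ∑ a, ∑ b, (∫ ω, ((U ω)ᵀ * Y ω) a b) * ∫ ω, ((U ω - Y ω)ᵀ * (U ω - Y ω)) a b := by
      rw [integral_finsetSum _ fun a _ => integrable_finsetSum _ fun b _ => (hΔ a b).const_mul _]
      refine Finset.sum_congr rfl fun a _ => ?_
      rw [integral_finsetSum _ fun b _ => (hΔ a b).const_mul _]
      exact Finset.sum_congr rfl fun b _ => integral_const_mul _ _
    rw [← hint]
    exact integral_nonneg fun ω => sum_mul_transpose_mul_self_nonneg hPSD (U ω - Y ω)
  have hleft : ∫ p : Ω × Ω, ∑ i, ∑ i', (((U p.1 - Y p.1) * (U p.2 - Y p.2)ᵀ) i i') ^ 2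
      ∂(Measure.prod ℙ ℙ) = ∑ a, ∑ b, (∫ ω, ((U ω - Y ω)ᵀ * (U ω - Y ω)) a b) ^ 2 := by
    simp only [pow_two, sum_mul_transpose_mul_sum_mul_transpose]
    simpa only [pow_two] using
      integral_sum_mul_prod (fun ω a b => ((U ω - Y ω)ᵀ * (U ω - Y ω)) a b) hΔ
  have hright : ∫ p : Ω × Ω, ∑ i, ∑ i', ((U p.1 * (U p.2)ᵀ - Y p.1 * (Y p.2)ᵀ) i i') ^ 2
      ∂(Measure.prod ℙ ℙ) = (∑ a, ∑ b, (∫ ω, ((U ω)ᵀ * U ω) a b) ^ 2)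
        + (∑ a, ∑ b, (∫ ω, ((Y ω)ᵀ * Y ω) a b) ^ 2)
        - 2 * ∑ a, ∑ b, (∫ ω, ((U ω)ᵀ * Y ω) a b) ^ 2 := by
    have hsum (f : Ω → Matrix (Fin k) (Fin k) ℝ) (hf : ∀ a b, Integrable (fun ω => f ω a b) ℙ) :
        Integrable (fun p : Ω × Ω => ∑ a, ∑ b, f p.1 a b * f p.2 a b) (Measure.prod ℙ ℙ) :=
      integrable_finsetSum _ fun a _ => integrable_finsetSum _ fun b _ =>
        (hf a b).mul_prod (hf a b)
    simp only [sum_sq_sub_mul_transpose, Finset.sum_sub_distrib, Finset.sum_add_distrib,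
      ← Finset.mul_sum]
    rw [integral_add_sub (hsum _ hUU) (hsum _ hYY) ((hsum _ hIntUY).const_mul 2),
      integral_const_mul,
      integral_sum_mul_prod _ hUU, integral_sum_mul_prod _ hYY, integral_sum_mul_prod _ hIntUY]
  rw [hleft, hright]
  simp only [hΔ_integral] at hcross ⊢
  have hsq : 0 ≤ ∑ a, ∑ b, ((∫ ω, ((U ω)ᵀ * U ω) a b) - ∫ ω, ((Y ω)ᵀ * Y ω) a b) ^ 2 :=
    Finset.sum_nonneg fun a _ => Finset.sum_nonneg fun b _ => sq_nonneg _
  rw [← sub_nonneg]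
  refine (add_nonneg (mul_nonneg one_half_pos.le hsq)
    (mul_nonneg zero_le_two hcross)).trans_eq ?_
  simp only [Finset.mul_sum, ← Finset.sum_add_distrib, ← Finset.sum_sub_distrib]
  exact Finset.sum_congr rfl fun a _ => Finset.sum_congr rfl fun b _ => by ring
end

section
/- Let U, Y: Ω → ℝ^{m×k} be random matrices such that E[U(X)^⊤ Y(X)] is positive semidefinite, and let X, X' be i.i.d. Then E‖U(X)U(X')^⊤ − Y(X)Y(X')^⊤‖_F² ≥ 2(√2 − 1)·E‖(U(X)−Y(X))·U(X')^⊤‖_F². -/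
open MeasureTheory ProbabilityTheory Matrix

/-- The Frobenius pairing of `P Qᵀ` and `R Sᵀ` is that of `Pᵀ R` and `Qᵀ S`. -/
theorem sum_mul_transpose_mul_mul_transpose {m n k : Type*} [Fintype m] [Fintype n] [Fintype k]
    (P R : Matrix m k ℝ) (Q S : Matrix n k ℝ) :
    ∑ i, ∑ i', (P * Qᵀ) i i' * (R * Sᵀ) i i' = ∑ j, ∑ l, (Pᵀ * R) j l * (Qᵀ * S) j l := by
  simp only [← hadamard_apply]
  rw [sum_hadamard_eq, sum_hadamard_eq, ← trace_transpose (Pᵀ * R * _)]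
  simp only [transpose_mul, transpose_transpose]
  rw [trace_mul_comm (Qᵀ * S), ← Matrix.mul_assoc, trace_mul_comm _ Rᵀ]
  simp only [Matrix.mul_assoc]

/-- A vector-valued function whose inner product with an independent copy of itself is integrable
is integrable in every direction. -/
theorem integrable_inner_of_integrable_inner_prod {Ω E : Type*} [MeasurableSpace Ω]
    {μ : Measure Ω} [SFinite μ] [NormedAddCommGroup E] [InnerProductSpace ℝ E]
    [FiniteDimensional ℝ E] {f : Ω → E}
    (hf : Integrable (fun p : Ω × Ω => inner ℝ (f p.1) (f p.2)) (μ.prod μ)) (v : E) :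
    Integrable (fun ω => inner ℝ (f ω) v) μ := by
  have hae := hf.prod_left_ae
  set W : Submodule ℝ E :=
    Submodule.span ℝ (f '' {y | Integrable (fun x => inner ℝ (f x) (f y)) μ}) with hW
  have hint : ∀ w ∈ W, Integrable (fun ω => inner ℝ (f ω) w) μ := by
    intro w hw
    induction hw using Submodule.span_induction with
    | mem w hw =>
      obtain ⟨y, hy, rfl⟩ := hw
      exact hy
    | zero => simp
    | add x y _ _ hx hy =>
      exact (hx.add hy).congr (.of_forall fun ω => (inner_add_right (f ω) x y).symm)
    | smul c x _ hx => simpa only [inner_smul_right] using hx.const_mul c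
  refine (hint _ (W.starProjection_apply_mem v)).congr ?_
  filter_upwards [hae] with ω hω
  have hmem : f ω ∈ W := Submodule.subset_span ⟨ω, hω, rfl⟩
  rw [← W.inner_starProjection_left_eq_right, Submodule.starProjection_eq_self_iff.2 hmem]

/-- A vector-valued function whose coordinatewise dot product with an independent copy of itself
is integrable has integrable coordinates. -/
theorem integrable_apply_of_integrable_sum_mul {Ω ι : Type*} [MeasurableSpace Ω]
    {μ : Measure Ω} [SFinite μ] [Fintype ι] {f : Ω → ι → ℝ}
    (hf : Integrable (fun p : Ω × Ω => ∑ i, f p.1 i * f p.2 i) (μ.prod μ)) (i : ι) :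
    Integrable (fun ω => f ω i) μ := by
  classical
  have h := integrable_inner_of_integrable_inner_prod (μ := μ)
    (f := fun ω => WithLp.toLp 2 (f ω)) (by simpa [PiLp.inner_apply, mul_comm] using hf)
    (EuclideanSpace.single i 1)
  simpa [EuclideanSpace.inner_single_right] using h

theorem sum_mul_transpose_mul_self_nonneg_s9 {m k : Type*} [Fintype m] [Fintype k]
    {C : Matrix k k ℝ} (hC : C.PosSemidef) (M : Matrix m k ℝ) :
    0 ≤ ∑ i, ∑ j, C i j * (Mᵀ * M) i j := by
  have h : ∑ i, ∑ j, C i j * (Mᵀ * M) i j = ∑ r, M r ⬝ᵥ (C *ᵥ M r) := by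
    simp only [mul_apply, transpose_apply, dotProduct, mulVec, Finset.mul_sum]
    rw [Finset.sum_comm_cycle]
    refine Finset.sum_congr rfl fun r _ => ?_
    refine Finset.sum_congr rfl fun i _ => Finset.sum_congr rfl fun j _ => ?_
    ring
  rw [h]
  exact Finset.sum_nonneg fun r _ => by simpa using hC.dotProduct_mulVec_nonneg (M r)

/-- The deterministic inequality between the second moments `a = E[UᵀU]`, `b = E[YᵀY]` and
`c = E[UᵀY]`. -/
theorem two_mul_sqrt_two_sub_one_mul_sum_le {k : Type*} [Fintype k] {a b c : k → k → ℝ}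
    (hc : ∀ i j, c j i = c i j)
    (hnonneg : 0 ≤ ∑ i, ∑ j, c i j * (a i j + b i j - c i j - c j i)) :
    2 * (√2 - 1) * ∑ i, ∑ j, (a i j * a i j + b i j * a i j - 2 * (c i j * a i j)) ≤
      ∑ i, ∑ j, (a i j * a i j + b i j * b i j - 2 * (c i j * c i j)) := by
  have h2 : √2 * √2 = 2 := Real.mul_self_sqrt (by norm_num)
  have hs : √2 ≤ 2 := Real.sqrt_le_iff.2 (by norm_num)
  have hsq : 0 ≤ ∑ i, ∑ j, (√2 * (a i j - c i j) - (a i j + b i j - 2 * c i j)) ^ 2 := by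
    positivity
  have key : ∑ i, ∑ j, (a i j * a i j + b i j * b i j - 2 * (c i j * c i j)) =
      2 * (√2 - 1) * ∑ i, ∑ j, (a i j * a i j + b i j * a i j - 2 * (c i j * a i j)) +
      ∑ i, ∑ j, (√2 * (a i j - c i j) - (a i j + b i j - 2 * c i j)) ^ 2 +
      (4 - 2 * √2) * ∑ i, ∑ j, c i j * (a i j + b i j - c i j - c j i) := by
    simp only [Finset.mul_sum, ← Finset.sum_add_distrib, hc]
    refine Finset.sum_congr rfl fun i _ => Finset.sum_congr rfl fun j _ => ?_
    linear_combination (-(a i j - c i j) ^ 2) * h2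
  have := mul_nonneg (by linarith : 0 ≤ 4 - 2 * √2) hnonneg
  linarith

/-- For random matrices `U, Y` with `E[UᵀY]` positive semidefinite and an i.i.d. pair
(modeled by the product measure `ℙ ⊗ ℙ`),
`E‖U(X)U(X')ᵀ − Y(X)Y(X')ᵀ‖_F² ≥ 2(√2−1)·E‖(U(X)−Y(X))U(X′)ᵀ‖_F²`. -/
theorem stmt9 {Ω : Type*} [MeasureSpace Ω] [IsProbabilityMeasure (ℙ : Measure Ω)]
    {m k : ℕ} (U Y : Ω → Matrix (Fin m) (Fin k) ℝ)
    (hIntUY : ∀ i j, Integrable (fun ω => ((U ω)ᵀ * Y ω) i j) ℙ)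
    (hInt₁ : Integrable (fun p : Ω × Ω =>
        ∑ i, ∑ i', ((U p.1 * (U p.2)ᵀ - Y p.1 * (Y p.2)ᵀ) i i') ^ 2) (Measure.prod ℙ ℙ))
    (hInt₂ : Integrable (fun p : Ω × Ω =>
        ∑ i, ∑ i', (((U p.1 - Y p.1) * (U p.2)ᵀ) i i') ^ 2) (Measure.prod ℙ ℙ))
    (hPSD : (Matrix.of fun i j => ∫ ω, ((U ω)ᵀ * Y ω) i j).PosSemidef) :
    (2 * (Real.sqrt 2 - 1)) * ∫ p : Ω × Ω,
        ∑ i, ∑ i', (((U p.1 - Y p.1) * (U p.2)ᵀ) i i') ^ 2 ∂(Measure.prod ℙ ℙ)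
      ≤ ∫ p : Ω × Ω,
        ∑ i, ∑ i', ((U p.1 * (U p.2)ᵀ - Y p.1 * (Y p.2)ᵀ) i i') ^ 2 ∂(Measure.prod ℙ ℙ) := by
  have hF₁ (p : Ω × Ω) :
      ∑ i, ∑ i', ((U p.1 * (U p.2)ᵀ - Y p.1 * (Y p.2)ᵀ) i i') ^ 2 =
        ∑ i, ∑ j, (((U p.1)ᵀ * U p.1) i j * ((U p.2)ᵀ * U p.2) i j +
          ((Y p.1)ᵀ * Y p.1) i j * ((Y p.2)ᵀ * Y p.2) i j -
          2 * (((U p.1)ᵀ * Y p.1) i j * ((U p.2)ᵀ * Y p.2) i j)) := by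
    simp only [Finset.sum_add_distrib, Finset.sum_sub_distrib, ← Finset.mul_sum,
      ← sum_mul_transpose_mul_mul_transpose]
    simp only [Finset.mul_sum, ← Finset.sum_add_distrib, ← Finset.sum_sub_distrib]
    refine Finset.sum_congr rfl fun i _ => Finset.sum_congr rfl fun j _ => ?_
    rw [Matrix.sub_apply]
    ring
  have hF₂ (p : Ω × Ω) :
      ∑ i, ∑ i', (((U p.1 - Y p.1) * (U p.2)ᵀ) i i') ^ 2 =
        ∑ i, ∑ j, (((U p.1)ᵀ * U p.1) i j * ((U p.2)ᵀ * U p.2) i j +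
          ((Y p.1)ᵀ * Y p.1) i j * ((U p.2)ᵀ * U p.2) i j -
          2 * (((U p.1)ᵀ * Y p.1) i j * ((U p.2)ᵀ * U p.2) i j)) := by
    simp only [Finset.sum_add_distrib, Finset.sum_sub_distrib, ← Finset.mul_sum,
      ← sum_mul_transpose_mul_mul_transpose]
    simp only [Finset.mul_sum, ← Finset.sum_add_distrib, ← Finset.sum_sub_distrib]
    refine Finset.sum_congr rfl fun i _ => Finset.sum_congr rfl fun j _ => ?_
    rw [Matrix.sub_mul, Matrix.sub_apply]
    ring
  have hGram := integrable_apply_of_integrable_sum_mul (μ := (ℙ : Measure Ω))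
    (f := fun ω => Sum.elim (fun q : Fin k × Fin k => ((U ω)ᵀ * U ω) q.1 q.2)
      (fun q : Fin k × Fin k => ((Y ω)ᵀ * Y ω) q.1 q.2)) (by
    have hC : Integrable (fun p : Ω × Ω => ∑ i, ∑ j,
        2 * (((U p.1)ᵀ * Y p.1) i j * ((U p.2)ᵀ * Y p.2) i j)) (Measure.prod ℙ ℙ) :=
      integrable_finsetSum _ fun i _ => integrable_finsetSum _ fun j _ =>
        ((hIntUY i j).mul_prod (hIntUY i j)).const_mul 2
    refine (hInt₁.add hC).congr (.of_forall fun p => ?_)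
    simp only [Pi.add_apply, hF₁, Fintype.sum_sum_type, Sum.elim_inl, Sum.elim_inr,
      Fintype.sum_prod_type, Finset.sum_sub_distrib, Finset.sum_add_distrib]
    ring)
  have hIntUU (i j) : Integrable (fun ω => ((U ω)ᵀ * U ω) i j) ℙ := hGram (.inl (i, j))
  have hIntYY (i j) : Integrable (fun ω => ((Y ω)ᵀ * Y ω) i j) ℙ := hGram (.inr (i, j))
  have integral_sum_eq {f g h f' g' h' : Ω → Fin k → Fin k → ℝ}
      (hf : ∀ i j, Integrable (fun ω => f ω i j) ℙ) (hg : ∀ i j, Integrable (fun ω => g ω i j) ℙ)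
      (hh : ∀ i j, Integrable (fun ω => h ω i j) ℙ)
      (hf' : ∀ i j, Integrable (fun ω => f' ω i j) ℙ)
      (hg' : ∀ i j, Integrable (fun ω => g' ω i j) ℙ)
      (hh' : ∀ i j, Integrable (fun ω => h' ω i j) ℙ) :
      ∫ p : Ω × Ω, ∑ i, ∑ j, (f p.1 i j * f' p.2 i j + g p.1 i j * g' p.2 i j -
          2 * (h p.1 i j * h' p.2 i j)) ∂(Measure.prod ℙ ℙ) =
        ∑ i, ∑ j, ((∫ ω, f ω i j) * (∫ ω, f' ω i j) + (∫ ω, g ω i j) * (∫ ω, g' ω i j) -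
          2 * ((∫ ω, h ω i j) * (∫ ω, h' ω i j))) := by
    have h₁ (i j) := (hf i j).mul_prod (hf' i j)
    have h₂ (i j) := (hg i j).mul_prod (hg' i j)
    have h₃ (i j) := ((hh i j).mul_prod (hh' i j)).const_mul 2
    have h₁₂ (i j) : Integrable (fun p : Ω × Ω =>
        f p.1 i j * f' p.2 i j + g p.1 i j * g' p.2 i j) (Measure.prod ℙ ℙ) :=
      (h₁ i j).add (h₂ i j)
    have h₁₂₃ (i j) : Integrable (fun p : Ω × Ω =>
        f p.1 i j * f' p.2 i j + g p.1 i j * g' p.2 i j -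
          2 * (h p.1 i j * h' p.2 i j)) (Measure.prod ℙ ℙ) :=
      (h₁₂ i j).sub (h₃ i j)
    rw [integral_finsetSum _ fun i _ => integrable_finsetSum _ fun j _ => h₁₂₃ i j]
    refine Finset.sum_congr rfl fun i _ => ?_
    rw [integral_finsetSum _ fun j _ => h₁₂₃ i j]
    refine Finset.sum_congr rfl fun j _ => ?_
    rw [integral_sub (h₁₂ i j) (h₃ i j), integral_add (h₁ i j) (h₂ i j),
      integral_const_mul, integral_prod_mul (fun ω => f ω i j) (fun ω => f' ω i j),
      integral_prod_mul (fun ω => g ω i j) (fun ω => g' ω i j),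
      integral_prod_mul (fun ω => h ω i j) (fun ω => h' ω i j)]
  simp only [hF₁, hF₂]
  rw [integral_sum_eq hIntUU hIntYY hIntUY hIntUU hIntUU hIntUU,
    integral_sum_eq hIntUU hIntYY hIntUY hIntUU hIntYY hIntUY]
  refine two_mul_sqrt_two_sub_one_mul_sum_le (a := fun i j => ∫ ω, ((U ω)ᵀ * U ω) i j)
    (b := fun i j => ∫ ω, ((Y ω)ᵀ * Y ω) i j) (c := fun i j => ∫ ω, ((U ω)ᵀ * Y ω) i j)
    (fun i j => by simpa using hPSD.isHermitian.apply i j) ?_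
  have hD (i j) (ω) : ((U ω - Y ω)ᵀ * (U ω - Y ω)) i j = ((U ω)ᵀ * U ω) i j +
      ((Y ω)ᵀ * Y ω) i j - ((U ω)ᵀ * Y ω) i j - ((U ω)ᵀ * Y ω) j i := by
    have hYU : ((U ω)ᵀ * Y ω) j i = ((Y ω)ᵀ * U ω) i j := by
      rw [← transpose_apply ((U ω)ᵀ * Y ω), transpose_mul, transpose_transpose]
    rw [hYU, transpose_sub, Matrix.sub_mul, Matrix.mul_sub, Matrix.mul_sub]
    simp only [Matrix.sub_apply]
    ring
  have hIntAdd (i j) : Integrable (fun ω => ((U ω)ᵀ * U ω) i j + ((Y ω)ᵀ * Y ω) i j) ℙ :=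
    (hIntUU i j).add (hIntYY i j)
  have hIntSub (i j) : Integrable (fun ω =>
      ((U ω)ᵀ * U ω) i j + ((Y ω)ᵀ * Y ω) i j - ((U ω)ᵀ * Y ω) i j) ℙ :=
    (hIntAdd i j).sub (hIntUY i j)
  have hIntD (i j) : Integrable (fun ω => ((U ω - Y ω)ᵀ * (U ω - Y ω)) i j) ℙ := by
    simp only [hD]
    exact (hIntSub i j).sub (hIntUY j i)
  have hmean (i j) : ∫ ω, ((U ω - Y ω)ᵀ * (U ω - Y ω)) i j =
      (∫ ω, ((U ω)ᵀ * U ω) i j) + (∫ ω, ((Y ω)ᵀ * Y ω) i j) -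
        (∫ ω, ((U ω)ᵀ * Y ω) i j) - ∫ ω, ((U ω)ᵀ * Y ω) j i := by
    simp only [hD]
    rw [integral_sub (hIntSub i j) (hIntUY j i), integral_sub (hIntAdd i j) (hIntUY i j),
      integral_add (hIntUU i j) (hIntYY i j)]
  have hnonneg : 0 ≤ ∫ ω, ∑ i, ∑ j, (∫ ω', ((U ω')ᵀ * Y ω') i j) *
      ((U ω - Y ω)ᵀ * (U ω - Y ω)) i j :=
    integral_nonneg fun ω => sum_mul_transpose_mul_self_nonneg_s9 hPSD (U ω - Y ω)
  rw [integral_finsetSum _ fun i _ => integrable_finsetSum _ fun j _ =>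
    (hIntD i j).const_mul _] at hnonneg
  refine hnonneg.trans_eq (Finset.sum_congr rfl fun i _ => ?_)
  rw [integral_finsetSum _ fun j _ => (hIntD i j).const_mul _]
  refine Finset.sum_congr rfl fun j _ => ?_
  rw [integral_const_mul, hmean]
end
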